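/- Let G = {Λ ∈ GL(4,ℝ) : Λᵀ η Λ = η} be the topological group of Lorentz matrices, topologized as a subspace of the 4×4 real matrices, and for A ∈ SL(2,ℂ) let λ(A) denote the unique real 4×4 matrix with Aᴴ X(v) A = X(λ(A)·v) for all v ∈ ℝ⁴. Then the set {λ(A) : A ∈ SL(2,ℂ)} is exactly the connected component of the identity in G. In particular, every Lorentz matrix lying in the identity component of G has the form λ(A) for some A ∈ SL(2,ℂ), and every λ(A) lies in the identity component of G. (SL(2,ℂ) covers the restricted Lorentz group SO⁺(1,3).) -/

import Mathlib

open Matrix Complex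

/-- The Hermitian matrix `X(v)` associated with `v = (t,x,y,z) ∈ ℝ⁴`. -/
noncomputable def Xmat (v : Fin 4 → ℝ) : Matrix (Fin 2) (Fin 2) ℂ :=
  !![(v 0 : ℂ) + v 3, (v 1 : ℂ) + I * v 2;
     (v 1 : ℂ) - I * v 2, (v 0 : ℂ) - v 3]

/-- The Minkowski matrix `η = diag(1,−1,−1,−1)`. -/
noncomputable def etaMink : Matrix (Fin 4) (Fin 4) ℝ :=
  Matrix.diagonal ![1, -1, -1, -1]

/-- The set of Lorentz matrices, `Λᵀ η Λ = η`. -/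
def LorentzSet : Set (Matrix (Fin 4) (Fin 4) ℝ) :=
  {Λ | Λᵀ * etaMink * Λ = etaMink}
/-- The Minkowski quadratic form is the determinant of the associated Hermitian matrix. -/
lemma det_Xmat (v : Fin 4 → ℝ) :
    (Xmat v).det = ((v 0 ^ 2 - v 1 ^ 2 - v 2 ^ 2 - v 3 ^ 2 : ℝ) : ℂ) := by
  simp only [Xmat, det_fin_two_of]
  push_cast
  linear_combination (v 2 : ℂ) ^ 2 * I_sq

lemma Xmat_injective : Function.Injective Xmat := by
  intro v w h
  have h00 := congrArg re (congrFun (congrFun h 0) 0)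
  have h11 := congrArg re (congrFun (congrFun h 1) 1)
  have h01 := congrFun (congrFun h 0) 1
  have hx := congrArg re h01
  have hy := congrArg im h01
  simp [Xmat] at h00 h11 hx hy
  funext i
  fin_cases i
  · change v 0 = w 0; linarith
  · exact hx
  · exact hy
  · change v 3 = w 3; linarith

lemma Xmat_smul (r : ℝ) (v : Fin 4 → ℝ) : Xmat (r • v) = (r : ℂ) • Xmat v := by
  ext i j
  fin_cases i <;> fin_cases j <;> simp [Xmat] <;> ring

lemma Xmat_add (v w : Fin 4 → ℝ) : Xmat (v + w) = Xmat v + Xmat w := by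
  ext i j
  fin_cases i <;> fin_cases j <;> simp [Xmat] <;> ring

/-- The coordinates of a Hermitian `2 × 2` matrix, inverting `Xmat`. -/
noncomputable def hermCoord (H : Matrix (Fin 2) (Fin 2) ℂ) : Fin 4 → ℝ :=
  ![((H 0 0).re + (H 1 1).re) / 2, (H 0 1).re, (H 0 1).im, ((H 0 0).re - (H 1 1).re) / 2]

lemma Xmat_hermCoord {H : Matrix (Fin 2) (Fin 2) ℂ} (hH : H.IsHermitian) :
    Xmat (hermCoord H) = H := by
  have h00 : (H 0 0).im = 0 := conj_eq_iff_im.mp (hH.apply 0 0)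
  have h11 : (H 1 1).im = 0 := conj_eq_iff_im.mp (hH.apply 1 1)
  have h10 : H 1 0 = star (H 0 1) := (hH.apply 1 0).symm
  ext i j
  fin_cases i <;> fin_cases j <;> apply Complex.ext <;>
    simp [Xmat, hermCoord, h00, h11, h10] <;> ring

lemma isHermitian_Xmat (v : Fin 4 → ℝ) : (Xmat v).IsHermitian := by
  ext i j
  fin_cases i <;> fin_cases j <;> simp [Xmat, sub_eq_add_neg]

lemma hermCoord_Xmat (v : Fin 4 → ℝ) : hermCoord (Xmat v) = v :=
  Xmat_injective (Xmat_hermCoord (isHermitian_Xmat v))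

lemma hermCoord_add (H K : Matrix (Fin 2) (Fin 2) ℂ) :
    hermCoord (H + K) = hermCoord H + hermCoord K := by
  ext i
  fin_cases i <;> simp [hermCoord] <;> ring

lemma hermCoord_smul (r : ℝ) (H : Matrix (Fin 2) (Fin 2) ℂ) :
    hermCoord ((r : ℂ) • H) = r • hermCoord H := by
  ext i
  fin_cases i <;> simp [hermCoord] <;> ring

/-- The linear map `v ↦ X⁻¹(Aᴴ X(v) A)` on `ℝ⁴`. -/
noncomputable def spinorLin (A : Matrix (Fin 2) (Fin 2) ℂ) : (Fin 4 → ℝ) →ₗ[ℝ] (Fin 4 → ℝ) where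
  toFun v := hermCoord (Aᴴ * Xmat v * A)
  map_add' v w := by rw [Xmat_add, mul_add, add_mul, hermCoord_add]
  map_smul' r v := by
    rw [Xmat_smul, mul_smul_comm, smul_mul_assoc, hermCoord_smul, RingHom.id_apply]

/-- The real `4 × 4` matrix `λ(A)` determined by `Aᴴ X(v) A = X(λ(A) v)`, for any complex `A`. -/
noncomputable def spinorMap (A : Matrix (Fin 2) (Fin 2) ℂ) : Matrix (Fin 4) (Fin 4) ℝ :=
  LinearMap.toMatrix' (spinorLin A)

lemma Xmat_spinorMap_mulVec (A : Matrix (Fin 2) (Fin 2) ℂ) (v : Fin 4 → ℝ) :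
    Xmat (spinorMap A *ᵥ v) = Aᴴ * Xmat v * A := by
  rw [spinorMap, LinearMap.toMatrix'_mulVec]
  exact Xmat_hermCoord (isHermitian_conjTranspose_mul_mul A (isHermitian_Xmat v))

lemma eq_spinorMap_of_forall {A : Matrix (Fin 2) (Fin 2) ℂ} {Λ : Matrix (Fin 4) (Fin 4) ℝ}
    (h : ∀ v, Aᴴ * Xmat v * A = Xmat (Λ *ᵥ v)) : Λ = spinorMap A :=
  ext_of_mulVec_single fun _ =>
    Xmat_injective ((h _).symm.trans (Xmat_spinorMap_mulVec A _).symm)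

lemma spinorMap_mul (A B : Matrix (Fin 2) (Fin 2) ℂ) :
    spinorMap (A * B) = spinorMap B * spinorMap A := by
  refine (eq_spinorMap_of_forall fun v => ?_).symm
  rw [← mulVec_mulVec, Xmat_spinorMap_mulVec, Xmat_spinorMap_mulVec, conjTranspose_mul]
  simp only [Matrix.mul_assoc]

lemma spinorMap_one : spinorMap 1 = 1 :=
  (eq_spinorMap_of_forall fun v => by simp).symm

lemma continuous_hermCoord : Continuous hermCoord := by
  unfold hermCoord
  refine continuous_pi fun i => ?_
  fin_cases i <;> simp <;> fun_prop

lemma continuous_spinorMap : Continuous spinorMap := by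
  refine continuous_matrix fun i j => ?_
  simp only [spinorMap, LinearMap.toMatrix'_apply, spinorLin, LinearMap.coe_mk, AddHom.coe_mk]
  refine (continuous_apply i).comp (continuous_hermCoord.comp ?_)
  fun_prop

/-- A matrix preserving the Minkowski quadratic form is a Lorentz matrix. -/
lemma mem_LorentzSet_of_det_Xmat {Λ : Matrix (Fin 4) (Fin 4) ℝ}
    (h : ∀ v, (Xmat (Λ *ᵥ v)).det = (Xmat v).det) : Λ ∈ LorentzSet := by
  simp only [det_Xmat, ofReal_inj] at h
  have hs (i : Fin 4) := h (Pi.single i 1)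
  have hp (i j : Fin 4) := h (Pi.single i 1 + Pi.single j 1)
  simp only [mulVec_add, mulVec_single_one, Pi.add_apply, col_apply] at hs hp
  change Λᵀ * etaMink * Λ = etaMink
  ext i j
  have hi := hs i
  have hj := hs j
  have hij := hp i j
  simp only [etaMink, mul_apply, Fin.sum_univ_four, transpose_apply]
  fin_cases i <;> fin_cases j <;> simp at hi hj hij ⊢ <;> linarith

lemma det_Xmat_spinorMap (A : Matrix (Fin 2) (Fin 2) ℂ) (v : Fin 4 → ℝ) :
    (Xmat (spinorMap A *ᵥ v)).det = ((‖A.det‖ ^ 2 : ℝ) : ℂ) * (Xmat v).det := by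
  rw [Xmat_spinorMap_mulVec, det_mul, det_mul, det_conjTranspose, ofReal_pow, ← conj_mul']
  simp only [RCLike.star_def]
  ring

lemma inv_norm_det_smul_spinorMap_mem {A : Matrix (Fin 2) (Fin 2) ℂ} (hA : A.det ≠ 0) :
    ‖A.det‖⁻¹ • spinorMap A ∈ LorentzSet := by
  refine mem_LorentzSet_of_det_Xmat fun v => ?_
  have hA' : (‖A.det‖ : ℂ) ≠ 0 := by simpa using hA
  rw [smul_mulVec, Xmat_smul, det_smul, det_Xmat_spinorMap, Fintype.card_fin]
  push_cast
  field_simp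

lemma spinorMap_mem_LorentzSet {A : Matrix (Fin 2) (Fin 2) ℂ} (hA : A.det = 1) :
    spinorMap A ∈ LorentzSet := by
  simpa [hA] using inv_norm_det_smul_spinorMap_mem (A := A) (by simp [hA])

lemma one_mem_LorentzSet : (1 : Matrix (Fin 4) (Fin 4) ℝ) ∈ LorentzSet := by
  simp [LorentzSet]

/-- The complex line through `1` and `A` meets the singular matrices in at most two points, and
`A ↦ ‖det A‖⁻¹ • λ(A)` carries the rest of it to a connected set of Lorentz matrices. -/
lemma spinorMap_mem_component {A : Matrix (Fin 2) (Fin 2) ℂ} (hA : A.det = 1) :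
    spinorMap A ∈ connectedComponentIn LorentzSet 1 := by
  let L : ℂ → Matrix (Fin 2) (Fin 2) ℂ := fun z => 1 + z • (A - 1)
  have hL : Continuous L := by fun_prop
  have hL0 : L 0 = 1 := by simp [L]
  have hL1 : L 1 = A := by simp [L]
  let p : Polynomial ℂ :=
    (1 + Polynomial.X * Polynomial.C (A 0 0 - 1)) * (1 + Polynomial.X * Polynomial.C (A 1 1 - 1)) -
      Polynomial.X * Polynomial.C (A 0 1) * (Polynomial.X * Polynomial.C (A 1 0))
  have hp (z : ℂ) : p.eval z = (L z).det := by
    simp [p, L, det_fin_two]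
    ring
  have hp0 : p ≠ 0 := by
    intro h
    have := hp 0
    simp [h, hL0] at this
  have hS : {z | (L z).det = 0}.Countable := by
    refine (p.roots.toFinset.finite_toSet.subset fun z hz => ?_).countable
    simpa [hp0, hp] using hz
  have hconn : IsPreconnected {z | (L z).det = 0}ᶜ :=
    (hS.isPathConnected_compl_of_one_lt_rank
      (by rw [rank_real_complex]; norm_num)).isConnected.isPreconnected
  let f : ℂ → Matrix (Fin 4) (Fin 4) ℝ := fun z => ‖(L z).det‖⁻¹ • spinorMap (L z)
  have hf : ContinuousOn f {z | (L z).det = 0}ᶜ :=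
    (hL.matrix_det.norm.continuousOn.inv₀ fun z hz => norm_ne_zero_iff.mpr hz).smul
      (continuous_spinorMap.comp hL).continuousOn
  refine (hconn.image f hf).subset_connectedComponentIn ⟨0, ?_, ?_⟩ ?_ ⟨1, ?_, ?_⟩
  · simp [hL0]
  · simp [f, hL0, spinorMap_one]
  · rintro _ ⟨z, hz, rfl⟩
    exact inv_norm_det_smul_spinorMap_mem hz
  · simp [hL1, hA]
  · simp [f, hL1, hA]

lemma pos_of_mem_component {f : Matrix (Fin 4) (Fin 4) ℝ → ℝ} (hf : Continuous f)
    (hne : ∀ Λ ∈ LorentzSet, f Λ ≠ 0) (h1 : 0 < f 1) {Λ : Matrix (Fin 4) (Fin 4) ℝ}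
    (hΛ : Λ ∈ connectedComponentIn LorentzSet 1) : 0 < f Λ := by
  by_contra! hneg
  obtain ⟨M, hM, hM0⟩ := isPreconnected_connectedComponentIn.intermediate_value hΛ
    (mem_connectedComponentIn one_mem_LorentzSet) hf.continuousOn ⟨hneg, h1.le⟩
  exact hne M (connectedComponentIn_subset _ _ hM) hM0

lemma etaMink_mul_self : etaMink * etaMink = 1 := by
  rw [etaMink, diagonal_mul_diagonal, ← diagonal_one]
  congr 1
  ext i
  fin_cases i <;> simp

lemma LorentzSet_mul {Λ M : Matrix (Fin 4) (Fin 4) ℝ} (hΛ : Λ ∈ LorentzSet)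
    (hM : M ∈ LorentzSet) : Λ * M ∈ LorentzSet := by
  change _ = _ at hΛ hM ⊢
  rw [transpose_mul]
  calc Mᵀ * Λᵀ * etaMink * (Λ * M) = Mᵀ * (Λᵀ * etaMink * Λ) * M := by
        simp only [Matrix.mul_assoc]
    _ = etaMink := by rw [hΛ, hM]

lemma LorentzSet_transpose {Λ : Matrix (Fin 4) (Fin 4) ℝ} (hΛ : Λ ∈ LorentzSet) :
    Λᵀ ∈ LorentzSet := by
  change _ = _ at hΛ ⊢
  have h : (etaMink * Λᵀ * etaMink) * Λ = 1 := by
    rw [Matrix.mul_assoc etaMink, Matrix.mul_assoc etaMink, hΛ, etaMink_mul_self]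
  have h' := mul_eq_one_comm.mp h
  calc Λᵀᵀ * etaMink * Λᵀ = Λ * (etaMink * Λᵀ * etaMink) * etaMink := by
        simp only [transpose_transpose, Matrix.mul_assoc, etaMink_mul_self, Matrix.mul_one]
    _ = etaMink := by rw [h', Matrix.one_mul]

lemma LorentzSet_col_eq {Λ : Matrix (Fin 4) (Fin 4) ℝ} (hΛ : Λ ∈ LorentzSet) (i j : Fin 4) :
    Λ 0 i * Λ 0 j - Λ 1 i * Λ 1 j - Λ 2 i * Λ 2 j - Λ 3 i * Λ 3 j = etaMink i j := by
  have h := congrFun (congrFun hΛ i) j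
  rw [← h]
  simp [etaMink, mul_apply, Fin.sum_univ_four, diagonal_apply]
  ring

lemma det_ne_zero_of_mem_LorentzSet {Λ : Matrix (Fin 4) (Fin 4) ℝ} (hΛ : Λ ∈ LorentzSet) :
    Λ.det ≠ 0 := by
  intro h
  have h1 := congrArg det (show Λᵀ * etaMink * Λ = etaMink from hΛ)
  have h2 := congrArg det etaMink_mul_self
  rw [det_mul, h, mul_zero] at h1
  rw [det_mul, ← h1] at h2
  simp at h2

lemma apply_zero_zero_ne_zero_of_mem_LorentzSet {Λ : Matrix (Fin 4) (Fin 4) ℝ}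
    (hΛ : Λ ∈ LorentzSet) : Λ 0 0 ≠ 0 := by
  intro h
  have h00 := LorentzSet_col_eq hΛ 0 0
  simp [etaMink, h] at h00
  nlinarith [sq_nonneg (Λ 1 0), sq_nonneg (Λ 2 0), sq_nonneg (Λ 3 0)]

lemma det_Xmat_mulVec {Λ : Matrix (Fin 4) (Fin 4) ℝ} (hΛ : Λ ∈ LorentzSet) (v : Fin 4 → ℝ) :
    (Xmat (Λ *ᵥ v)).det = (Xmat v).det := by
  have hq (w : Fin 4 → ℝ) : w 0 ^ 2 - w 1 ^ 2 - w 2 ^ 2 - w 3 ^ 2 = w ⬝ᵥ etaMink *ᵥ w := by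
    simp [etaMink, mulVec_diagonal, dotProduct, Fin.sum_univ_four]
    ring
  rw [det_Xmat, det_Xmat, hq, hq, ofReal_inj]
  conv_rhs => rw [← show Λᵀ * etaMink * Λ = etaMink from hΛ]
  rw [← mulVec_mulVec, ← mulVec_mulVec, dotProduct_mulVec v, vecMul_transpose]

/-- A future-pointing null vector corresponds to a Hermitian matrix of rank one. -/
lemma exists_Xmat_eq_of_null {p : Fin 4 → ℝ} (h0 : 0 ≤ p 0)
    (hp : (Xmat p).det = 0) :
    ∃ a b : ℂ, Xmat p =
      !![2 * (star a * a), 2 * (star a * b); 2 * (star b * a), 2 * (star b * b)] := by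
  rw [det_Xmat, ofReal_eq_zero] at hp
  have hle : |p 3| ≤ p 0 := abs_le_of_sq_le_sq (by nlinarith [sq_nonneg (p 1), sq_nonneg (p 2)]) h0
  obtain ⟨hl, hr⟩ := abs_le.mp hle
  rcases (show 0 ≤ p 0 + p 3 by linarith).eq_or_lt with h | h
  · have h1 : p 1 = 0 := by nlinarith [sq_nonneg (p 1), sq_nonneg (p 2)]
    have h2 : p 2 = 0 := by nlinarith [sq_nonneg (p 1), sq_nonneg (p 2)]
    have h3 : p 3 = - p 0 := by linarith
    refine ⟨0, (√(p 0) : ℝ), ?_⟩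
    have hs : ((√(p 0) : ℝ) : ℂ) * (√(p 0) : ℝ) = p 0 := by
      rw [← ofReal_mul, Real.mul_self_sqrt h0]
    ext i j
    fin_cases i <;> fin_cases j <;> simp [Xmat, h1, h2, h3, hs]
    ring
  · obtain ⟨r, hr0, hr⟩ : ∃ r : ℝ, 0 < r ∧ r * r = (p 0 + p 3) / 2 :=
      ⟨√((p 0 + p 3) / 2), Real.sqrt_pos.mpr (by linarith), Real.mul_self_sqrt (by linarith)⟩
    have hrc : (r : ℂ) * r = (p 0 + p 3) / 2 := by exact_mod_cast congrArg ((↑) : ℝ → ℂ) hr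
    have hr0' : (r : ℂ) ≠ 0 := by exact_mod_cast hr0.ne'
    have hpc : (p 0 : ℂ) ^ 2 - p 1 ^ 2 - p 2 ^ 2 - p 3 ^ 2 = 0 := by
      exact_mod_cast congrArg ((↑) : ℝ → ℂ) hp
    refine ⟨r, (p 1 + I * p 2) / (2 * r), ?_⟩
    ext i j
    fin_cases i <;> fin_cases j <;> simp [Xmat]
    · linear_combination -2 * hrc
    · field_simp
    · field_simp
      ring
    · field_simp
      linear_combination 2 * (p 0 - p 3 : ℂ) * hrc + hpc + (p 2 : ℂ) ^ 2 * I_sq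

/-- A Lorentz matrix with positive time-time entry agrees with some `λ(A)` on the null vectors
`(1,0,0,±1)`. -/
lemma exists_spinorMap_agree_on_null {Λ : Matrix (Fin 4) (Fin 4) ℝ} (hΛ : Λ ∈ LorentzSet)
    (h00 : 0 < Λ 0 0) :
    ∃ A : Matrix (Fin 2) (Fin 2) ℂ, A.det = 1 ∧
      Λ *ᵥ ![1, 0, 0, 1] = spinorMap A *ᵥ ![1, 0, 0, 1] ∧
      Λ *ᵥ ![1, 0, 0, -1] = spinorMap A *ᵥ ![1, 0, 0, -1] := by
  have hrow := LorentzSet_col_eq (LorentzSet_transpose hΛ) 0 0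
  simp [etaMink] at hrow
  have habs : |Λ 0 3| ≤ Λ 0 0 :=
    abs_le_of_sq_le_sq (by nlinarith [sq_nonneg (Λ 0 1), sq_nonneg (Λ 0 2)]) h00.le
  obtain ⟨hl, hr⟩ := abs_le.mp habs
  obtain ⟨a, b, hab⟩ := exists_Xmat_eq_of_null (p := Λ *ᵥ ![1, 0, 0, 1])
    (by simp [mulVec, dotProduct, Fin.sum_univ_four]; linarith)
    (by rw [det_Xmat_mulVec hΛ, det_Xmat]; simp)
  obtain ⟨c, d, hcd⟩ := exists_Xmat_eq_of_null (p := Λ *ᵥ ![1, 0, 0, -1])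
    (by simp [mulVec, dotProduct, Fin.sum_univ_four]; linarith)
    (by rw [det_Xmat_mulVec hΛ, det_Xmat]; simp)
  have hdet : star (a * d - b * c) * (a * d - b * c) = 1 := by
    have h := det_Xmat_mulVec hΛ (![1, 0, 0, 1] + ![1, 0, 0, -1])
    rw [mulVec_add, Xmat_add, hab, hcd, det_Xmat] at h
    simp [det_fin_two] at h
    simp
    linear_combination h / 4
  have hu : star (star (a * d - b * c)) * star (a * d - b * c) = 1 := by
    rw [star_star, mul_comm, hdet]
  set u := star (a * d - b * c) with hu_def
  refine ⟨!![u * a, u * b; c, d], ?_, Xmat_injective ?_, Xmat_injective ?_⟩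
  · rw [det_fin_two_of]
    linear_combination hdet
  · rw [hab, Xmat_spinorMap_mulVec]
    clear_value u
    simp only [RCLike.star_def] at hu
    ext i j
    fin_cases i <;> fin_cases j <;> simp [Xmat, mul_apply, Fin.sum_univ_two]
    · linear_combination -2 * (starRingEnd ℂ a) * a * hu
    · linear_combination -2 * (starRingEnd ℂ a) * b * hu
    · linear_combination -2 * (starRingEnd ℂ b) * a * hu
    · linear_combination -2 * (starRingEnd ℂ b) * b * hu
  · rw [hcd, Xmat_spinorMap_mulVec]
    ext i j
    fin_cases i <;> fin_cases j <;> simp [Xmat, mul_apply, Fin.sum_univ_two] <;> ring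

/-- A Lorentz matrix of positive determinant fixing the null vectors `(1,0,0,±1)` is a rotation
in the plane of the second and third coordinates. -/
lemma exists_spinorMap_of_fixes_null {M : Matrix (Fin 4) (Fin 4) ℝ} (hM : M ∈ LorentzSet)
    (hdet : 0 < M.det) (hp : M *ᵥ ![1, 0, 0, 1] = ![1, 0, 0, 1])
    (hm : M *ᵥ ![1, 0, 0, -1] = ![1, 0, 0, -1]) :
    ∃ B : Matrix (Fin 2) (Fin 2) ℂ, B.det = 1 ∧ M = spinorMap B := by
  have hpi (i : Fin 4) := congrFun hp i
  have hmi (i : Fin 4) := congrFun hm i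
  simp only [mulVec, dotProduct, Fin.sum_univ_four] at hpi hmi
  have hp0 := hpi 0
  have hp1 := hpi 1
  have hp2 := hpi 2
  have hp3 := hpi 3
  have hm0 := hmi 0
  have hm1 := hmi 1
  have hm2 := hmi 2
  have hm3 := hmi 3
  simp at hp0 hp1 hp2 hp3 hm0 hm1 hm2 hm3
  have e00 : M 0 0 = 1 := by linarith
  have e03 : M 0 3 = 0 := by linarith
  have e10 : M 1 0 = 0 := by linarith
  have e13 : M 1 3 = 0 := by linarith
  have e20 : M 2 0 = 0 := by linarith
  have e23 : M 2 3 = 0 := by linarith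
  have e30 : M 3 0 = 0 := by linarith
  have e33 : M 3 3 = 1 := by linarith
  have e01 : M 0 1 = 0 := by
    simpa [etaMink, e00, e10, e20, e30] using LorentzSet_col_eq hM 0 1
  have e02 : M 0 2 = 0 := by
    simpa [etaMink, e00, e10, e20, e30] using LorentzSet_col_eq hM 0 2
  have e31 : M 3 1 = 0 := by
    simpa [etaMink, e03, e13, e23, e33] using LorentzSet_col_eq hM 3 1
  have e32 : M 3 2 = 0 := by
    simpa [etaMink, e03, e13, e23, e33] using LorentzSet_col_eq hM 3 2
  have h11 := LorentzSet_col_eq hM 1 1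
  have h12 := LorentzSet_col_eq hM 1 2
  have h22 := LorentzSet_col_eq hM 2 2
  simp [etaMink, e01, e02, e31, e32] at h11 h12 h22
  have hD : M.det = M 1 1 * M 2 2 - M 1 2 * M 2 1 := by
    rw [det_succ_row_zero, Fin.sum_univ_four]
    simp [e00, e01, e02, e03, det_fin_three, Fin.succAbove, e33, e32, e31, e13, e23]
  rw [hD] at hdet
  have hD1 : M 1 1 * M 2 2 - M 1 2 * M 2 1 = 1 := by
    have : (M 1 1 * M 2 2 - M 1 2 * M 2 1) ^ 2 = 1 := by
      have h11' : M 1 1 * M 1 1 + M 2 1 * M 2 1 = 1 := by linarith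
      have h22' : M 1 2 * M 1 2 + M 2 2 * M 2 2 = 1 := by linarith
      have h12' : M 1 1 * M 1 2 + M 2 1 * M 2 2 = 0 := by linarith
      linear_combination (M 1 2 * M 1 2 + M 2 2 * M 2 2) * h11' + h22' -
        (M 1 1 * M 1 2 + M 2 1 * M 2 2) * h12'
    exact (pow_eq_one_iff_of_nonneg hdet.le two_ne_zero).mp this
  have hsq : (M 2 2 - M 1 1) ^ 2 + (M 1 2 + M 2 1) ^ 2 = 0 := by
    nlinarith only [h11, h22, hD1]
  have e22 : M 2 2 = M 1 1 := by
    nlinarith only [hsq, sq_nonneg (M 2 2 - M 1 1), sq_nonneg (M 1 2 + M 2 1)]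
  have e12 : M 1 2 = -M 2 1 := by
    nlinarith only [hsq, sq_nonneg (M 2 2 - M 1 1), sq_nonneg (M 1 2 + M 2 1)]
  obtain ⟨u, hu⟩ := IsAlgClosed.exists_pow_nat_eq (⟨M 1 1, M 2 1⟩ : ℂ) (n := 2) (by norm_num)
  have hnorm : normSq u = 1 := by
    have h := congrArg normSq hu
    rw [map_pow, normSq_mk (M 1 1)] at h
    refine (pow_eq_one_iff_of_nonneg (normSq_nonneg u) two_ne_zero).mp ?_
    linarith only [h, h11]
  have hnorm' : starRingEnd ℂ u * u = 1 := by
    rw [← normSq_eq_conj_mul_self, hnorm, ofReal_one]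
  have hu1 : u ^ 2 = M 1 1 + I * M 2 1 := by
    rw [hu, mk_eq_add_mul_I, mul_comm]
  have hu2 : (starRingEnd ℂ u) ^ 2 = M 1 1 - I * M 2 1 := by
    rw [← map_pow, hu1]
    simp [sub_eq_add_neg]
  refine ⟨!![starRingEnd ℂ u, 0; 0, u], by simp [det_fin_two, hnorm'],
    eq_spinorMap_of_forall fun v => ?_⟩
  ext i j
  fin_cases i <;> fin_cases j <;>
    simp [Xmat, mul_apply, mulVec, dotProduct, Fin.sum_univ_two, Fin.sum_univ_four,
      e00, e01, e02, e03, e10, e12, e13, e20, e22, e23, e30, e31, e32, e33]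
  · linear_combination (v 0 + v 3 : ℂ) * hnorm'
  · linear_combination (v 1 + I * v 2 : ℂ) * hu1 + (M 2 1 * v 2 : ℂ) * I_sq
  · linear_combination (v 1 - I * v 2 : ℂ) * hu2 + (M 2 1 * v 2 : ℂ) * I_sq
  · linear_combination (v 0 - v 3 : ℂ) * hnorm'

lemma exists_spinorMap_of_mem_component {Λ : Matrix (Fin 4) (Fin 4) ℝ}
    (hΛ : Λ ∈ connectedComponentIn LorentzSet 1) :
    ∃ A : Matrix (Fin 2) (Fin 2) ℂ, A.det = 1 ∧ Λ = spinorMap A := by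
  have hdet_pos {N : Matrix (Fin 4) (Fin 4) ℝ} (hN : N ∈ connectedComponentIn LorentzSet 1) :
      0 < N.det :=
    pos_of_mem_component (continuous_id.matrix_det)
      (fun _ h => det_ne_zero_of_mem_LorentzSet h) (by simp) hN
  have hL := connectedComponentIn_subset _ _ hΛ
  have h00 : 0 < Λ 0 0 :=
    pos_of_mem_component (f := fun N => N 0 0) (continuous_id.matrix_elem 0 0)
      (fun _ h => apply_zero_zero_ne_zero_of_mem_LorentzSet h) (by simp) hΛ
  obtain ⟨A, hA, hp, hm⟩ := exists_spinorMap_agree_on_null hL h00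
  have hAu : IsUnit A.det := by simp [hA]
  have hA' : A⁻¹.det = 1 := by simp [det_nonsing_inv, hA]
  have hinv : spinorMap A⁻¹ * spinorMap A = 1 := by
    rw [← spinorMap_mul, mul_nonsing_inv A hAu, spinorMap_one]
  obtain ⟨B, hB, hMB⟩ := exists_spinorMap_of_fixes_null (M := spinorMap A⁻¹ * Λ)
    (LorentzSet_mul (spinorMap_mem_LorentzSet hA') hL)
    (by
      rw [det_mul]
      exact mul_pos (hdet_pos (spinorMap_mem_component hA')) (hdet_pos hΛ))
    (by rw [← mulVec_mulVec, hp, mulVec_mulVec, hinv, one_mulVec])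
    (by rw [← mulVec_mulVec, hm, mulVec_mulVec, hinv, one_mulVec])
  refine ⟨B * A, by rw [det_mul, hA, hB, one_mul], ?_⟩
  rw [spinorMap_mul, ← hMB, ← Matrix.mul_assoc, mul_eq_one_comm.mp hinv, Matrix.one_mul]

/-- `SL(2,ℂ)` covers the restricted Lorentz group: a Lorentz matrix `Λ` lies in the
connected component of the identity in the group of Lorentz matrices iff
`Λ = λ(A)` for some `A ∈ SL(2,ℂ)`, i.e. `Aᴴ X(v) A = X(Λv)` for all `v`. -/
theorem sl2C_image_eq_identity_component :
    {Λ : Matrix (Fin 4) (Fin 4) ℝ | ∃ A : Matrix.SpecialLinearGroup (Fin 2) ℂ,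
        ∀ v : Fin 4 → ℝ,
          (A : Matrix (Fin 2) (Fin 2) ℂ)ᴴ * Xmat v * (A : Matrix (Fin 2) (Fin 2) ℂ) =
            Xmat (Λ.mulVec v)} =
      connectedComponentIn LorentzSet 1 := by
  ext Λ
  constructor
  · rintro ⟨A, hA⟩
    rw [eq_spinorMap_of_forall hA]
    exact spinorMap_mem_component A.det_coe
  · intro hΛ
    obtain ⟨A, hA, rfl⟩ := exists_spinorMap_of_mem_component hΛ
    exact ⟨⟨A, hA⟩, fun v => (Xmat_spinorMap_mulVec A v).symm⟩
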